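/- Consider any AR1pGN run for a function f satisfying AS.1 with Lipschitz constant L_{r,p}. Then the regularization parameters satisfy σ_k ≤ σ_max := γ₃ · max( σ₀, L_{r,p}/(1 − η₂) ) for all k ≥ 0. -/

import Mathlib

open scoped RealInnerProductSpace

noncomputable section

/-- Abbreviation for the Euclidean space `ℝ^n`. -/
abbrev E (n : ℕ) := EuclideanSpace ℝ (Fin n)

/-- `N` is a norm on `ℝ^n` (possibly non-smooth, e.g. `ℓ¹` or `ℓ∞`). -/
structure IsNorm (n : ℕ) (N : E n → ℝ) : Prop where
  add_le : ∀ x y, N (x + y) ≤ N x + N y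
  smul : ∀ (c : ℝ) (x : E n), N (c • x) = |c| * N x
  eq_zero : ∀ x, N x = 0 → x = 0

/-- The dual norm `‖v‖_{N,1} := max_{N s = 1} ⟪v, s⟫`. -/
def dualNorm (n : ℕ) (N : E n → ℝ) (v : E n) : ℝ :=
  sSup {t : ℝ | ∃ s, N s = 1 ∧ t = ⟪v, s⟫}

/-- The norm `‖S‖_{N,ℓ} := max_{N s = 1} |S[s,…,s]|` of an `ℓ`-linear form induced by `N`. -/
def tensorNorm (n p : ℕ) (N : E n → ℝ)
    (S : ContinuousMultilinearMap ℝ (fun _ : Fin p => E n) ℝ) : ℝ :=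
  sSup {t : ℝ | ∃ s, N s = 1 ∧ t = |S (fun _ => s)|}

/-- The `p`-th order Taylor polynomial
`T_{f,p}(x,s) = f(x) + Σ_{ℓ=1}^p (1/ℓ!) ∇^ℓ f(x)[s]^ℓ`. -/
def Tay (n p : ℕ) (f : E n → ℝ) (x s : E n) : ℝ :=
  f x + ∑ ℓ ∈ Finset.Icc 1 p, (1 / (ℓ.factorial : ℝ)) * iteratedFDeriv ℝ ℓ f x (fun _ => s)

/-- The regularized model `m_k(s) = T_{f,p}(x,s) + (σ_k/(p+1)!) N(s)^{p+1}`. -/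
def model (n p : ℕ) (N : E n → ℝ) (f : E n → ℝ) (σk : ℝ) (x s : E n) : ℝ :=
  Tay n p f x s + σk / ((p + 1).factorial : ℝ) * N s ^ (p + 1)

/-- The ratio `ρ = (f(x) − f(x+s))/(T_{f,p}(x,0) − T_{f,p}(x,s))`. -/
def rho (n p : ℕ) (f : E n → ℝ) (x s : E n) : ℝ :=
  (f x - f (x + s)) / (Tay n p f x 0 - Tay n p f x s)

/-- An AR1pGN run for `f` with starting point `x0`, initial regularization
parameter `σ0` and parameters `σmin, η1, η2, γ1, γ2, γ3, θ1`. -/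
structure AR1Run (n p : ℕ) (N : E n → ℝ) (f : E n → ℝ) (x0 : E n)
    (σmin σ0 η1 η2 γ1 γ2 γ3 θ1 : ℝ) where
  x : ℕ → E n
  s : ℕ → E n
  σ : ℕ → ℝ
  x_init : x 0 = x0
  σ_init : σ 0 = σ0
  s_ne : ∀ k, s k ≠ 0
  σ_pos : ∀ k, 0 < σ k
  /-- (i) sufficient model decrease `m_k(s_k) ≤ m_k(0)` -/
  descent : ∀ k, model n p N f (σ k) (x k) (s k) ≤ model n p N f (σ k) (x k) 0
  /-- (ii) `‖∇_s T_{f,p}(x_k,s_k)‖_{N,1} ≤ θ1 (σ_k/p!) N(s_k)^p` -/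
  term_model : ∀ k,
    dualNorm n N (gradient (fun t => Tay n p f (x k) t) (s k)) ≤
      θ1 * (σ k / (p.factorial : ℝ)) * N (s k) ^ p
  /-- (iii) successful step -/
  succ_step : ∀ k, η1 ≤ rho n p f (x k) (s k) → x (k + 1) = x k + s k
  /-- (iii) unsuccessful step -/
  fail_step : ∀ k, rho n p f (x k) (s k) < η1 → x (k + 1) = x k
  /-- (iv) very successful update -/
  σ_vsucc : ∀ k, η2 ≤ rho n p f (x k) (s k) →
    max σmin (γ1 * σ k) ≤ σ (k + 1) ∧ σ (k + 1) ≤ σ k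
  /-- (iv) successful update -/
  σ_succ : ∀ k, η1 ≤ rho n p f (x k) (s k) → rho n p f (x k) (s k) < η2 →
    σ k ≤ σ (k + 1) ∧ σ (k + 1) ≤ γ2 * σ k
  /-- (iv) unsuccessful update -/
  σ_fail : ∀ k, rho n p f (x k) (s k) < η1 →
    γ2 * σ k ≤ σ (k + 1) ∧ σ (k + 1) ≤ γ3 * σ k

theorem taylor_upper_bound_of_lipschitz_deriv {M : ℝ} (p : ℕ) (G : ℕ → ℝ → ℝ)
    (hG : ∀ l < p, ∀ t, HasDerivAt (G l) (G (l + 1) t) t)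
    (hM : ∀ t, 0 ≤ t → G p t - G p 0 ≤ M * t) :
    ∀ t, 0 ≤ t → G 0 t ≤ ∑ l ∈ Finset.range (p + 1), G l 0 * (t ^ l / (l.factorial : ℝ)) +
      M * (t ^ (p + 1) / ((p + 1).factorial : ℝ)) := by
  have hmono : ∀ (l : ℕ) (t : ℝ), HasDerivAt (fun t : ℝ => t ^ (l + 1) / ((l + 1).factorial : ℝ))
      (t ^ l / (l.factorial : ℝ)) t := by
    intro l t
    refine ((hasDerivAt_pow (l + 1) t).div_const _).congr_deriv ?_
    rw [Nat.factorial_succ]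
    push_cast
    field_simp
  induction p generalizing G with
  | zero =>
    intro t ht
    have := hM t ht
    simp
    linarith
  | succ p ih =>
    intro t ht
    have hG' := ih (fun l => G (l + 1)) (fun l hl => hG (l + 1) (by omega)) hM
    set F : ℝ → ℝ := fun t => (∑ l ∈ Finset.range (p + 1),
      G (l + 1) 0 * (t ^ (l + 1) / ((l + 1).factorial : ℝ))) +
      M * (t ^ (p + 1 + 1) / ((p + 1 + 1).factorial : ℝ)) with hF
    have hFd : ∀ t, HasDerivAt F ((∑ l ∈ Finset.range (p + 1),
        G (l + 1) 0 * (t ^ l / (l.factorial : ℝ))) +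
        M * (t ^ (p + 1) / ((p + 1).factorial : ℝ))) t := fun t =>
      (HasDerivAt.fun_sum fun l _ => (hmono l t).const_mul _).add ((hmono (p + 1) t).const_mul M)
    have hd : ∀ t, HasDerivAt (fun t => F t - G 0 t) _ t :=
      fun t => (hFd t).sub (hG 0 (Nat.succ_pos p) t)
    have hmon : MonotoneOn (fun t => F t - G 0 t) (Set.Ici 0) := by
      refine monotoneOn_of_deriv_nonneg (convex_Ici 0)
        (fun t _ => (hd t).continuousAt.continuousWithinAt)
        (fun t _ => (hd t).differentiableAt.differentiableWithinAt) fun t ht => ?_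
      rw [interior_Ici] at ht
      rw [(hd t).deriv]
      exact sub_nonneg.2 (hG' t (le_of_lt ht))
    have h := hmon (Set.mem_Ici.2 le_rfl) (Set.mem_Ici.2 ht) ht
    have hF0 : F 0 = 0 := by simp [hF]
    rw [Finset.sum_range_succ']
    simp only [hF0] at h
    simp only [hF] at h
    simp
    linarith

theorem hasDerivAt_iteratedFDeriv_line {V : Type*} [NormedAddCommGroup V] [NormedSpace ℝ V]
    {p : ℕ} {f : V → ℝ} (hf : ContDiff ℝ p f) (x s : V) {l : ℕ} (hl : l < p) (t : ℝ) :
    HasDerivAt (fun t : ℝ => iteratedFDeriv ℝ l f (x + t • s) (fun _ => s))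
      (iteratedFDeriv ℝ (l + 1) f (x + t • s) (fun _ => s)) t := by
  have h1 : HasDerivAt (fun t : ℝ => x + t • s) s t := by
    simpa using ((hasDerivAt_id t).smul_const s).const_add x
  have h2 := ((hf.differentiable_iteratedFDeriv (m := l) (by exact_mod_cast hl)
    (x + t • s)).hasFDerivAt).comp_hasDerivAt t h1
  have h3 := ((ContinuousMultilinearMap.apply ℝ (fun _ : Fin l => V) ℝ
    (fun _ => s)).hasFDerivAt).comp_hasDerivAt t h2
  exact h3.congr_deriv (by rw [iteratedFDeriv_succ_apply_left]; rfl)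

namespace IsNorm

variable {n : ℕ} {N : E n → ℝ}

/-- The bundled seminorm underlying a norm. -/
def toSeminorm (hN : IsNorm n N) : Seminorm ℝ (E n) :=
  Seminorm.of N hN.add_le hN.smul

theorem pos (hN : IsNorm n N) {x : E n} (hx : x ≠ 0) : 0 < N x :=
  lt_of_le_of_ne (apply_nonneg hN.toSeminorm x) fun h => hx (hN.eq_zero x h.symm)

theorem map_zero (hN : IsNorm n N) : N 0 = 0 :=
  _root_.map_zero hN.toSeminorm

theorem exists_mul_norm_le (hN : IsNorm n N) : ∃ c : ℝ, 0 < c ∧ ∀ x, c * ‖x‖ ≤ N x := by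
  have hc : Continuous N := hN.toSeminorm.convexOn.locallyLipschitz.continuous
  rcases (Metric.sphere (0 : E n) 1).eq_empty_or_nonempty with h | h
  · refine ⟨1, one_pos, fun x => ?_⟩
    have hx : x = 0 := by
      by_contra hx
      have : ‖x‖⁻¹ • x ∈ Metric.sphere (0 : E n) 1 := by
        simp [norm_smul, hx]
      simp [h] at this
    simp [hx, hN.map_zero]
  · obtain ⟨y, hy, hmin⟩ := (isCompact_sphere (0 : E n) 1).exists_isMinOn h hc.continuousOn
    refine ⟨N y, hN.pos ?_, fun x => ?_⟩
    · rintro rfl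
      simp at hy
    · by_cases hx : x = 0
      · simp [hx, hN.map_zero]
      · have hm : N y ≤ N (‖x‖⁻¹ • x) := hmin (by simp [norm_smul, hx])
        rw [hN.smul, abs_of_nonneg (by positivity)] at hm
        have hp : 0 < ‖x‖ := norm_pos_iff.2 hx
        rwa [inv_mul_eq_div, le_div_iff₀ hp] at hm

theorem abs_apply_le_tensorNorm (hN : IsNorm n N) {p : ℕ}
    (S : ContinuousMultilinearMap ℝ (fun _ : Fin p => E n) ℝ) {s : E n} (hs : s ≠ 0) :
    |S fun _ => s| ≤ tensorNorm n p N S * N s ^ p := by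
  obtain ⟨c, hc, hcN⟩ := hN.exists_mul_norm_le
  have hpos := hN.pos hs
  have hbdd : BddAbove {t : ℝ | ∃ s, N s = 1 ∧ t = |S (fun _ => s)|} := by
    refine ⟨‖S‖ * c⁻¹ ^ p, ?_⟩
    rintro _ ⟨u, hu, rfl⟩
    have hu' : ‖u‖ ≤ c⁻¹ := by
      rw [← one_div, le_div_iff₀ hc, mul_comm, ← hu]
      exact hcN u
    exact S.le_opNorm_mul_pow_of_le ((pi_norm_const_le u).trans hu')
  have hle := le_csSup hbdd ⟨(N s)⁻¹ • s, by
    rw [hN.smul, abs_of_pos (inv_pos.2 hpos), inv_mul_cancel₀ hpos.ne'], rfl⟩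
  rw [S.map_smul_univ (fun _ => (N s)⁻¹) (fun _ => s)] at hle
  simp only [Finset.prod_const, Finset.card_univ, Fintype.card_fin, smul_eq_mul, abs_mul,
    inv_pow, abs_inv, abs_of_pos (pow_pos hpos p)] at hle
  rwa [inv_mul_eq_div, div_le_iff₀ (pow_pos hpos p)] at hle

theorem apply_add_le_Tay (hN : IsNorm n N) {p : ℕ} {f : E n → ℝ} (hf : ContDiff ℝ p f) {L : ℝ}
    (hLip : ∀ x y : E n,
      tensorNorm n p N (iteratedFDeriv ℝ p f x - iteratedFDeriv ℝ p f y) ≤ L * N (x - y))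
    (x : E n) {s : E n} (hs : s ≠ 0) :
    f (x + s) ≤ Tay n p f x s + L / ((p + 1).factorial : ℝ) * N s ^ (p + 1) := by
  have hpos := hN.pos hs
  have h := taylor_upper_bound_of_lipschitz_deriv (M := L * N s ^ (p + 1)) p
    (fun l t => iteratedFDeriv ℝ l f (x + t • s) (fun _ => s))
    (fun l hl t => hasDerivAt_iteratedFDeriv_line hf x s hl t) (fun t ht => by
      have h1 := hN.abs_apply_le_tensorNorm
        (iteratedFDeriv ℝ p f (x + t • s) - iteratedFDeriv ℝ p f (x + (0 : ℝ) • s)) hs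
      have h2 := hLip (x + t • s) (x + (0 : ℝ) • s)
      rw [show x + t • s - (x + (0 : ℝ) • s) = t • s by simp, hN.smul, abs_of_nonneg ht] at h2
      calc _ ≤ _ := le_abs_self _
        _ ≤ _ := h1
        _ ≤ L * (t * N s) * N s ^ p := by gcongr
        _ = _ := by ring) 1 zero_le_one
  rw [Finset.sum_range_succ'] at h
  simp only [one_smul, zero_smul, add_zero, one_pow, iteratedFDeriv_zero_apply,
    Nat.factorial_zero, Nat.cast_one, div_one, mul_one] at h
  rw [Finset.range_eq_Ico, Finset.sum_Ico_add' (fun l => iteratedFDeriv ℝ l f x (fun _ => s) *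
    (1 / (l.factorial : ℝ))) 0 p 1, zero_add, Finset.Ico_add_one_right_eq_Icc] at h
  simp only [Tay, mul_comm (1 / _ : ℝ)]
  refine h.trans (le_of_eq ?_)
  ring

end IsNorm

theorem Tay_zero {n p : ℕ} (f : E n → ℝ) (x : E n) : Tay n p f x 0 = f x := by
  rw [Tay, Finset.sum_eq_zero, add_zero]
  intro l hl
  rw [ContinuousMultilinearMap.map_coord_zero _ (⟨0, (Finset.mem_Icc.1 hl).1⟩ : Fin l) rfl,
    mul_zero]

/-- in any AR1pGN run for `f` satisfying AS.1, the regularization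
parameters satisfy `σ_k ≤ σ_max = γ3 max(σ0, L/(1−η2))` for all `k`. -/
theorem stmt6 {n p : ℕ} (hn : 1 ≤ n) (hp : 1 ≤ p) (N : E n → ℝ) (hN : IsNorm n N)
    (f : E n → ℝ) (hf : ContDiff ℝ p f) (L : ℝ) (hL : 0 ≤ L)
    (hLip : ∀ x y : E n,
      tensorNorm n p N (iteratedFDeriv ℝ p f x - iteratedFDeriv ℝ p f y) ≤ L * N (x - y))
    (x0 : E n) (σmin σ0 η1 η2 γ1 γ2 γ3 θ1 : ℝ)
    (hσmin : 0 < σmin) (hσ0 : σmin ≤ σ0)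
    (hη1 : 0 < η1) (hη12 : η1 ≤ η2) (hη2 : η2 < 1)
    (hγ1 : 0 < γ1) (hγ11 : γ1 < 1) (hγ2 : 1 < γ2) (hγ23 : γ2 < γ3) (hθ1 : 1 < θ1)
    (run : AR1Run n p N f x0 σmin σ0 η1 η2 γ1 γ2 γ3 θ1) :
    ∀ k, run.σ k ≤ γ3 * max σ0 (L / (1 - η2)) := by
  have hvs : ∀ k, L / (1 - η2) ≤ run.σ k → η2 ≤ rho n p f (run.x k) (run.s k) := by
    intro k hk
    have hpos := pow_pos (hN.pos (run.s_ne k)) (p + 1)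
    have hfac : (0 : ℝ) < ((p + 1).factorial : ℝ) := by positivity
    have hd := run.descent k
    have hT := hN.apply_add_le_Tay hf hLip (run.x k) (run.s_ne k)
    simp only [model, hN.map_zero, Tay_zero, zero_pow (Nat.succ_ne_zero p), mul_zero,
      add_zero] at hd
    rw [div_le_iff₀ (by linarith)] at hk
    have hσ := mul_pos (div_pos (run.σ_pos k) hfac) hpos
    rw [rho, Tay_zero, le_div_iff₀ (by linarith)]
    have hLσ : L / ((p + 1).factorial : ℝ) * N (run.s k) ^ (p + 1) ≤
        (1 - η2) * (run.σ k / ((p + 1).factorial : ℝ) * N (run.s k) ^ (p + 1)) := by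
      rw [← mul_assoc, ← mul_div_assoc, mul_comm (1 - η2)]
      gcongr
    nlinarith
  have hγ3 : 1 < γ3 := hγ2.trans hγ23
  have hmax : 0 < max σ0 (L / (1 - η2)) := lt_max_of_lt_left (hσmin.trans_le hσ0)
  intro k
  induction k with
  | zero =>
    rw [run.σ_init]
    nlinarith [le_max_left σ0 (L / (1 - η2))]
  | succ k ih =>
    by_cases hvk : η2 ≤ rho n p f (run.x k) (run.s k)
    · exact (run.σ_vsucc k hvk).2.trans ih
    have hlt : run.σ k ≤ max σ0 (L / (1 - η2)) :=
      (le_of_lt (not_le.1 fun h => hvk (hvs k h))).trans (le_max_right _ _)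
    have hσ := run.σ_pos k
    have hstep : run.σ (k + 1) ≤ γ3 * run.σ k := by
      by_cases hsk : η1 ≤ rho n p f (run.x k) (run.s k)
      · exact (run.σ_succ k hsk (not_le.1 hvk)).2.trans (by gcongr)
      · exact (run.σ_fail k (not_le.1 hsk)).2
    exact hstep.trans (by gcongr)
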